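/- For any base 𝓑 and any basic sentence p: the translated clause set [𝓑] intuitionistically proves p ([𝓑] ⊢ p) if and only if p is derivable in the base 𝓑 from the empty set of premises (∅ ⊢_𝓑 p). -/

import Mathlib

/-- Formulas of intuitionistic propositional logic over a countably infinite
set of atomic propositions (basic sentences), identified with `ℕ`. -/
inductive Formula : Type where
  | atom : ℕ → Formula
  | bot  : Formula
  | and  : Formula → Formula → Formula
  | or   : Formula → Formula → Formula
  | imp  : Formula → Formula → Formula
deriving DecidableEq

/-- Derivability in intuitionistic propositional natural deduction (NJ)
from a set of hypotheses. -/
inductive NJ : Set Formula → Formula → Prop where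
  | hyp   {Γ : Set Formula} {φ : Formula}     : φ ∈ Γ → NJ Γ φ
  | andI  {Γ : Set Formula} {φ ψ : Formula}   : NJ Γ φ → NJ Γ ψ → NJ Γ (φ.and ψ)
  | andE1 {Γ : Set Formula} {φ ψ : Formula}   : NJ Γ (φ.and ψ) → NJ Γ φ
  | andE2 {Γ : Set Formula} {φ ψ : Formula}   : NJ Γ (φ.and ψ) → NJ Γ ψ
  | orI1  {Γ : Set Formula} {φ ψ : Formula}   : NJ Γ φ → NJ Γ (φ.or ψ)
  | orI2  {Γ : Set Formula} {φ ψ : Formula}   : NJ Γ ψ → NJ Γ (φ.or ψ)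
  | orE   {Γ : Set Formula} {φ ψ χ : Formula} : NJ Γ (φ.or ψ) → NJ (insert φ Γ) χ → NJ (insert ψ Γ) χ → NJ Γ χ
  | impI  {Γ : Set Formula} {φ ψ : Formula}   : NJ (insert φ Γ) ψ → NJ Γ (φ.imp ψ)
  | impE  {Γ : Set Formula} {φ ψ : Formula}   : NJ Γ (φ.imp ψ) → NJ Γ φ → NJ Γ ψ
  | botE  {Γ : Set Formula} {φ : Formula}     : NJ Γ Formula.bot → NJ Γ φ

/-- An atomic rule: either a nullary rule `ε ⇒ c`, or a general rule
`(P₁ ⇒ p₁),…,(Pₙ ⇒ pₙ) ⇒ c` with `n ≥ 1` (encoded as head premise plus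
a list of further premises), where each premise is a pair of a finite set
of basic sentences and a basic sentence. -/
inductive AtomicRule : Type where
  | nullary : ℕ → AtomicRule
  | general : (Finset ℕ × ℕ) → List (Finset ℕ × ℕ) → ℕ → AtomicRule

/-- A base is a set of atomic rules. -/
abbrev Base := Set AtomicRule

/-- Derivability in a base `B`: the smallest relation `P ⊢_B p` closed under
the three clauses. -/
inductive BaseDer (B : Base) : Set ℕ → ℕ → Prop where
  | hyp {P : Set ℕ} {p : ℕ} : p ∈ P → BaseDer B P p
  | nullary {P : Set ℕ} {c : ℕ} : AtomicRule.nullary c ∈ B → BaseDer B P c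
  | general {P : Set ℕ} {hd : Finset ℕ × ℕ} {tl : List (Finset ℕ × ℕ)} {c : ℕ} :
      AtomicRule.general hd tl c ∈ B →
      (∀ pr ∈ hd :: tl, BaseDer B (P ∪ ↑pr.1) pr.2) →
      BaseDer B P c

/-- Sandqvist's support relation `⊩_B φ`, defined by recursion on the
structure of `φ` (equivalently, on logical weight). -/
def Supp : Base → Formula → Prop
  | B, .atom p  => BaseDer B ∅ p
  | B, .bot     => ∀ p : ℕ, BaseDer B ∅ p
  | B, .and φ ψ => Supp B φ ∧ Supp B ψ
  | B, .or φ ψ  => ∀ C : Base, B ⊆ C → ∀ p : ℕ,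
      (∀ D : Base, C ⊆ D → Supp D φ → BaseDer D ∅ p) →
      (∀ D : Base, C ⊆ D → Supp D ψ → BaseDer D ∅ p) →
      BaseDer C ∅ p
  | B, .imp φ ψ => ∀ C : Base, B ⊆ C → Supp C φ → Supp C ψ

/-- Support relative to a context: `Γ ⊩_B φ`. -/
def SuppCtx (Γ : Set Formula) (B : Base) (φ : Formula) : Prop :=
  ∀ C : Base, B ⊆ C → (∀ ψ ∈ Γ, Supp C ψ) → Supp C φ

/-- `f` is a (possibly iterated) conjunction `p₁ ∧ … ∧ pₙ` (n ≥ 1) of atoms. -/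
inductive AtomsConj : Formula → Prop where
  | atom (p : ℕ) : AtomsConj (.atom p)
  | and {a b : Formula} : AtomsConj a → AtomsConj b → AtomsConj (a.and b)

/-- `q*` : either a basic sentence or `⊥`. -/
def AtomOrBot (f : Formula) : Prop := (∃ p : ℕ, f = .atom p) ∨ f = .bot

/-- An intuitionistic clause in the sense of Mints: a formula of one of the
forms `(p → q*) → r`, `p → (q ∨ r)`, or `(p₁ ∧ … ∧ pₙ) → q*`. -/
inductive IsClause : Formula → Prop where
  | impImp (p r : ℕ) {q : Formula} : AtomOrBot q →
      IsClause (((Formula.atom p).imp q).imp (.atom r))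
  | impOr (p q r : ℕ) :
      IsClause ((Formula.atom p).imp ((Formula.atom q).or (.atom r)))
  | conjImp {a q : Formula} : AtomsConj a → AtomOrBot q →
      IsClause (a.imp q)

/-- A clausal system: a set of intuitionistic clauses. -/
def ClausalSystem (C : Set Formula) : Prop := ∀ f ∈ C, IsClause f

/-- The set of subformulas of a formula. -/
def subf : Formula → Finset Formula
  | .atom p  => {.atom p}
  | .bot     => {.bot}
  | .and a b => insert (a.and b) (subf a ∪ subf b)
  | .or a b  => insert (a.or b) (subf a ∪ subf b)
  | .imp a b => insert (a.imp b) (subf a ∪ subf b)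

/-- `⊥` occurs in `φ` only as the conclusion of an implication. -/
def BotGuarded : Formula → Prop
  | .atom _  => True
  | .bot     => False
  | .and a b => BotGuarded a ∧ BotGuarded b
  | .or a b  => BotGuarded a ∧ BotGuarded b
  | .imp a b => BotGuarded a ∧ (b = .bot ∨ BotGuarded b)

/-- `fl` is a flattening for `φ`: an injection from `Ξ ∪ {⊥}` (where `Ξ` is
the set of subformulas of `φ`) into the basic sentences which fixes the
atoms of `Ξ`. -/
def FlatFor (fl : Formula → ℕ) (φ : Formula) : Prop :=
  (∀ a ∈ insert Formula.bot (subf φ), ∀ b ∈ insert Formula.bot (subf φ),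
      fl a = fl b → a = b) ∧
  (∀ p : ℕ, Formula.atom p ∈ subf φ → fl (.atom p) = p)

/-- The clauses `M_X(χ)` associated with a complex subformula `χ`, relative
to a set `X` of basic sentences. -/
def MX (fl : Formula → ℕ) (X : Set ℕ) : Formula → Set Formula
  | .and a b =>
      { (Formula.atom (fl (a.and b))).imp (.atom (fl a)),
        (Formula.atom (fl (a.and b))).imp (.atom (fl b)),
        ((Formula.atom (fl a)).and (.atom (fl b))).imp (.atom (fl (a.and b))) }
  | .or a b =>
      { (Formula.atom (fl a)).imp (.atom (fl (a.or b))),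
        (Formula.atom (fl b)).imp (.atom (fl (a.or b))) } ∪
      { f | ∃ x ∈ X, f =
          (((Formula.atom (fl (a.or b))).and
              ((Formula.atom (fl a)).imp (.atom x))).and
            ((Formula.atom (fl b)).imp (.atom x))).imp (.atom x) }
  | .imp a b =>
      { ((Formula.atom (fl a)).imp (.atom (fl b))).imp (.atom (fl (a.imp b))),
        ((Formula.atom (fl (a.imp b))).and (.atom (fl a))).imp (.atom (fl b)) }
  | _ => ∅

/-- The clause set `N := ⋃_{χ ∈ Ξ} M_𝔹(χ) ∪ {⊥♭ → x : x ∈ 𝔹}`, relative to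
all basic sentences. -/
def Nset (fl : Formula → ℕ) (φ : Formula) : Set Formula :=
  (⋃ χ ∈ (↑(subf φ) : Set Formula), MX fl Set.univ χ) ∪
  { f | ∃ x : ℕ, f = (Formula.atom (fl .bot)).imp (.atom x) }

/-- Right-nested conjunction of a nonempty list of atoms (`⊥` for the empty
list, which never occurs below). -/
def conjAtoms : List ℕ → Formula
  | []            => .bot
  | [p]           => .atom p
  | p :: q :: rest => (Formula.atom p).and (conjAtoms (q :: rest))

/-- Canonical conjunction `⋀X` of a finite set of atoms. -/
def bigConj (X : Finset ℕ) : Formula := conjAtoms (X.sort (· ≤ ·))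

/-- The atoms occurring in a formula. -/
def atomsOf : Formula → Finset ℕ
  | .atom p  => {p}
  | .bot     => ∅
  | .and a b => atomsOf a ∪ atomsOf b
  | .or a b  => atomsOf a ∪ atomsOf b
  | .imp a b => atomsOf a ∪ atomsOf b

/-- `X`, the range of the flattening `fl` on `Ξ ∪ {⊥}`. -/
def flatRange (fl : Formula → ℕ) (φ : Formula) : Finset ℕ :=
  (insert Formula.bot (subf φ)).image fl

/-- Mints' full clause set
`M_X := ⋃_{χ ∈ Ξ} M_X(χ) ∪ {(⋀X ∧ y) → ⊥♭} ∪ {⊥♭ → y} ∪ {⊥♭ → x : x ∈ X}`,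
where `y` is a fresh basic sentence. -/
def MXfull (fl : Formula → ℕ) (φ : Formula) (y : ℕ) : Set Formula :=
  (⋃ χ ∈ (↑(subf φ) : Set Formula), MX fl ↑(flatRange fl φ) χ) ∪
  { ((bigConj (flatRange fl φ)).and (.atom y)).imp (.atom (fl .bot)),
    (Formula.atom (fl .bot)).imp (.atom y) } ∪
  { f | ∃ x ∈ flatRange fl φ, f = (Formula.atom (fl .bot)).imp (.atom x) }

/-- `φ[q/⊥]`: replace every occurrence of `⊥` by the atom `q`. -/
def substBot (q : ℕ) : Formula → Formula
  | .atom p  => .atom p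
  | .bot     => .atom q
  | .and a b => (substBot q a).and (substBot q b)
  | .or a b  => (substBot q a).or (substBot q b)
  | .imp a b => (substBot q a).imp (substBot q b)

/-- Right-nested conjunction of a nonempty list of formulas. -/
def conjFmls : Formula → List Formula → Formula
  | f, []        => f
  | f, g :: rest => f.and (conjFmls g rest)

/-- The formula `⋀P → p` associated with a premise `(P ⇒ p)`, with
`⋀∅ → p` read as `p`. -/
def premFml (pr : Finset ℕ × ℕ) : Formula :=
  if pr.1 = ∅ then .atom pr.2
  else (conjAtoms (pr.1.sort (· ≤ ·))).imp (.atom pr.2)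

/-- The translation `[−]` from atomic rules to formulas:
`[ε ⇒ c] = c` and
`[(P₁ ⇒ p₁),…,(Pₙ ⇒ pₙ) ⇒ c] = ((⋀P₁ → p₁) ∧ … ∧ (⋀Pₙ → pₙ)) → c`. -/
def ruleTr : AtomicRule → Formula
  | .nullary c       => .atom c
  | .general hd tl c => (conjFmls (premFml hd) (tl.map premFml)).imp (.atom c)

/-- The translation of a base: `[𝓑] := {[r] : r ∈ 𝓑}`. -/
def baseTr (B : Base) : Set Formula := ruleTr '' B

theorem NJ.weaken {Γ Δ : Set Formula} {φ : Formula} (h : NJ Γ φ) (hs : Γ ⊆ Δ) : NJ Δ φ := by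
  induction h generalizing Δ with
  | hyp hm => exact .hyp (hs hm)
  | andI _ _ ih₁ ih₂ => exact .andI (ih₁ hs) (ih₂ hs)
  | andE1 _ ih => exact .andE1 (ih hs)
  | andE2 _ ih => exact .andE2 (ih hs)
  | orI1 _ ih => exact .orI1 (ih hs)
  | orI2 _ ih => exact .orI2 (ih hs)
  | orE _ _ _ ih ih₁ ih₂ =>
    exact .orE (ih hs) (ih₁ (Set.insert_subset_insert hs)) (ih₂ (Set.insert_subset_insert hs))
  | impI _ ih => exact .impI (ih (Set.insert_subset_insert hs))
  | impE _ _ ih₁ ih₂ => exact .impE (ih₁ hs) (ih₂ hs)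
  | botE _ ih => exact .botE (ih hs)

theorem NJ.conjFmls_intro {Γ : Set Formula} {f : Formula} {l : List Formula}
    (h : ∀ g ∈ f :: l, NJ Γ g) : NJ Γ (conjFmls f l) := by
  induction l generalizing f with
  | nil => exact h f (by simp)
  | cons g l ih =>
    exact .andI (h f (by simp)) (ih fun k hk => h k (List.mem_cons_of_mem _ hk))

theorem NJ.of_conjAtoms {Γ : Set Formula} {l : List ℕ} (h : NJ Γ (conjAtoms l)) {q : ℕ}
    (hq : q ∈ l) : NJ Γ (.atom q) := by
  induction l with
  | nil => simp at hq
  | cons a l ih =>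
    cases l with
    | nil =>
      obtain rfl := List.mem_singleton.1 hq
      exact h
    | cons b l =>
      rcases List.mem_cons.1 hq with rfl | hq
      · exact .andE1 h
      · exact ih (.andE2 h) hq

theorem BaseDer.mono {B : Base} {P Q : Set ℕ} {p : ℕ} (h : BaseDer B P p) (hs : P ⊆ Q) :
    BaseDer B Q p := by
  induction h generalizing Q with
  | hyp hm => exact .hyp (hs hm)
  | nullary hc => exact .nullary hc
  | general hr _ ih =>
    exact .general hr fun pr hpr => ih pr hpr (Set.union_subset_union_left _ hs)

/-- Derivability in a base is simulated in NJ by the translated rules, over any context that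
proves the premises. -/
theorem BaseDer.nj {B : Base} {P : Set ℕ} {p : ℕ} (h : BaseDer B P p) {Γ : Set Formula}
    (hB : baseTr B ⊆ Γ) (hP : ∀ q ∈ P, NJ Γ (.atom q)) : NJ Γ (.atom p) := by
  induction h generalizing Γ with
  | hyp hm => exact hP _ hm
  | nullary hc => exact .hyp (hB ⟨_, hc, rfl⟩)
  | @general P hd tl c hr _ ih =>
    refine .impE (.hyp (hB ⟨_, hr, rfl⟩)) (NJ.conjFmls_intro fun g hg => ?_)
    rw [← List.map_cons] at hg
    obtain ⟨pr, hpr, rfl⟩ := List.mem_map.1 hg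
    unfold premFml
    split_ifs with h0
    · exact ih pr hpr hB fun q hq => hP q (by simpa [h0] using hq)
    · refine .impI (ih pr hpr (hB.trans (Set.subset_insert _ _)) ?_)
      rintro q (hq | hq)
      · exact (hP q hq).weaken (Set.subset_insert _ _)
      · exact NJ.of_conjAtoms (.hyp (Set.mem_insert _ _)) ((Finset.mem_sort _).2 hq)

/-- Forcing over the sets of basic sentences ordered by inclusion, for a fixed base. -/
def Force (B : Base) : Set ℕ → Formula → Prop
  | P, .atom p => BaseDer B P p
  | P, .bot => ∀ p : ℕ, BaseDer B P p
  | P, .and φ ψ => Force B P φ ∧ Force B P ψ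
  | P, .or φ ψ => ∀ Q : Set ℕ, P ⊆ Q → ∀ p : ℕ,
      (∀ R : Set ℕ, Q ⊆ R → Force B R φ → BaseDer B R p) →
      (∀ R : Set ℕ, Q ⊆ R → Force B R ψ → BaseDer B R p) →
      BaseDer B Q p
  | P, .imp φ ψ => ∀ Q : Set ℕ, P ⊆ Q → Force B Q φ → Force B Q ψ

namespace Force

variable {B : Base} {P Q : Set ℕ}

theorem mono {φ : Formula} (h : Force B P φ) (hs : P ⊆ Q) : Force B Q φ := by
  induction φ with
  | atom p => exact BaseDer.mono h hs
  | bot => exact fun p => (h p).mono hs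
  | and φ ψ ih₁ ih₂ => exact ⟨ih₁ h.1, ih₂ h.2⟩
  | or φ ψ _ _ => exact fun R hR => h R (hs.trans hR)
  | imp φ ψ _ _ => exact fun R hR => h R (hs.trans hR)

theorem of_bot {φ : Formula} (h : Force B P .bot) : Force B P φ := by
  induction φ generalizing P with
  | atom p => exact h p
  | bot => exact h
  | and φ ψ ih₁ ih₂ => exact ⟨ih₁ h, ih₂ h⟩
  | or φ ψ _ _ => exact fun Q hQ p _ _ => (h p).mono hQ
  | imp φ ψ _ ih => exact fun Q hQ _ => ih (h.mono hQ)

theorem or_elim {φ ψ χ : Formula} (h : Force B P (φ.or ψ))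
    (h₁ : ∀ Q, P ⊆ Q → Force B Q φ → Force B Q χ)
    (h₂ : ∀ Q, P ⊆ Q → Force B Q ψ → Force B Q χ) : Force B P χ := by
  induction χ generalizing P with
  | atom p => exact h P subset_rfl p h₁ h₂
  | bot =>
    exact fun p => h P subset_rfl p (fun Q hQ hφ => h₁ Q hQ hφ p) (fun Q hQ hψ => h₂ Q hQ hψ p)
  | and χ₁ χ₂ ih₁ ih₂ =>
    exact ⟨ih₁ h (fun Q hQ hφ => (h₁ Q hQ hφ).1) (fun Q hQ hψ => (h₂ Q hQ hψ).1),
      ih₂ h (fun Q hQ hφ => (h₁ Q hQ hφ).2) (fun Q hQ hψ => (h₂ Q hQ hψ).2)⟩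
  | or χ₁ χ₂ _ _ =>
    intro Q hQ p k₁ k₂
    exact h Q hQ p
      (fun R hR hφ => h₁ R (hQ.trans hR) hφ R subset_rfl p
        (fun S hS => k₁ S (hR.trans hS)) (fun S hS => k₂ S (hR.trans hS)))
      (fun R hR hψ => h₂ R (hQ.trans hR) hψ R subset_rfl p
        (fun S hS => k₁ S (hR.trans hS)) (fun S hS => k₂ S (hR.trans hS)))
  | imp χ₁ χ₂ _ ih =>
    intro Q hQ hχ
    exact ih (h.mono hQ)
      (fun R hR hφ => h₁ R (hQ.trans hR) hφ R subset_rfl (hχ.mono hR))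
      (fun R hR hψ => h₂ R (hQ.trans hR) hψ R subset_rfl (hχ.mono hR))

theorem conjAtoms_intro {l : List ℕ} (hl : l ≠ []) (h : ∀ q ∈ l, BaseDer B P q) :
    Force B P (conjAtoms l) := by
  induction l with
  | nil => exact absurd rfl hl
  | cons a l ih =>
    cases l with
    | nil => exact h a (by simp)
    | cons b l =>
      exact ⟨h a (by simp), ih (by simp) fun q hq => h q (List.mem_cons_of_mem _ hq)⟩

theorem of_conjFmls {f : Formula} {l : List Formula} (h : Force B P (conjFmls f l)) :
    ∀ g ∈ f :: l, Force B P g := by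
  induction l generalizing f with
  | nil =>
    intro g hg
    obtain rfl := List.mem_singleton.1 hg
    exact h
  | cons k l ih =>
    intro g hg
    rcases List.mem_cons.1 hg with rfl | hg
    · exact h.1
    · exact ih h.2 g hg

theorem baseDer_of_premFml {pr : Finset ℕ × ℕ} (h : Force B P (premFml pr)) :
    BaseDer B (P ∪ ↑pr.1) pr.2 := by
  unfold premFml at h
  split_ifs at h with h0
  · exact BaseDer.mono h Set.subset_union_left
  · refine h _ Set.subset_union_left (conjAtoms_intro (fun hnil => h0 ?_) fun q hq => ?_)
    · rw [← Finset.sort_toFinset pr.1 (· ≤ ·), hnil, List.toFinset_nil]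
    · exact .hyp (Or.inr ((Finset.mem_sort _).1 hq))

theorem ruleTr {r : AtomicRule} (hr : r ∈ B) : Force B P (ruleTr r) := by
  cases r with
  | nullary c => exact BaseDer.nullary hr
  | general hd tl c =>
    intro Q _ hQ
    refine BaseDer.general hr fun pr hpr => baseDer_of_premFml (of_conjFmls hQ _ ?_)
    rw [← List.map_cons]
    exact List.mem_map_of_mem hpr

end Force

theorem NJ.force {B : Base} {Γ : Set Formula} {φ : Formula} (h : NJ Γ φ) {P : Set ℕ}
    (hΓ : ∀ ψ ∈ Γ, Force B P ψ) : Force B P φ := by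
  have extend {Γ : Set Formula} {P Q : Set ℕ} {φ : Formula} (hΓ : ∀ ψ ∈ Γ, Force B P ψ)
      (hQ : P ⊆ Q) (hφ : Force B Q φ) : ∀ ψ ∈ insert φ Γ, Force B Q ψ := by
    rintro ψ (rfl | hψ)
    · exact hφ
    · exact (hΓ ψ hψ).mono hQ
  induction h generalizing P with
  | hyp hm => exact hΓ _ hm
  | andI _ _ ih₁ ih₂ => exact ⟨ih₁ hΓ, ih₂ hΓ⟩
  | andE1 _ ih => exact (ih hΓ).1
  | andE2 _ ih => exact (ih hΓ).2
  | orI1 _ ih => exact fun Q hQ p h₁ _ => h₁ Q subset_rfl ((ih hΓ).mono hQ)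
  | orI2 _ ih => exact fun Q hQ p _ h₂ => h₂ Q subset_rfl ((ih hΓ).mono hQ)
  | orE _ _ _ ih ih₁ ih₂ =>
    exact (ih hΓ).or_elim (fun Q hQ hφ => ih₁ (extend hΓ hQ hφ))
      (fun Q hQ hψ => ih₂ (extend hΓ hQ hψ))
  | impI _ ih => exact fun Q hQ hφ => ih (extend hΓ hQ hφ)
  | impE _ _ ih₁ ih₂ => exact ih₁ hΓ P subset_rfl (ih₂ hΓ)
  | botE _ ih => exact (ih hΓ).of_bot

/-- `[𝓑] ⊢ p` iff `∅ ⊢_𝓑 p`. -/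
theorem baseTr_der_iff (B : Base) (p : ℕ) :
    NJ (baseTr B) (.atom p) ↔ BaseDer B ∅ p := by
  refine ⟨fun h => h.force (B := B) (P := ∅) ?_, fun h => h.nj subset_rfl (by simp)⟩
  rintro _ ⟨r, hr, rfl⟩
  exact Force.ruleTr hr
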